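/- (Lemma 2, curl-free part.) Let P_{ab} be a smooth symmetric 2-tensor on U satisfying D^bP_{ab} - D_aP = 0 and (□ - 3)P_{ab} + P h⁰_{ab} - D_aD_bP = 0 on U, where P = Σ_{a,b} h⁰^{ab}P_{ab}. Then the tensor T_{ab} = Σ_{c,d} ε_a{}^{cd} D_cP_{db} is curl-free: Σ_{c,d} ε_a{}^{cd} D_cT_{db} = 0 at every point of U and for all indices a,b. -/

import Mathlib

noncomputable section

/-- Points of the chart `U = ℝ × (0,π) × ℝ` with coordinates `(τ, θ, φ)`. -/
abbrev Pt : Type := Fin 3 → ℝ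

/-- The coordinate domain `U = ℝ × (0,π) × ℝ`. -/
def U : Set Pt := {x | 0 < x 1 ∧ x 1 < Real.pi}

/-- Partial derivative `∂_i f` at `x`. -/
noncomputable def pd (i : Fin 3) (f : Pt → ℝ) (x : Pt) : ℝ :=
  deriv (fun t => f (Function.update x i t)) (x i)

/-- The unit-hyperboloid (dS₃) metric `h⁰_{ab}`. -/
noncomputable def h0 (x : Pt) : Fin 3 → Fin 3 → ℝ :=
  ![![-1, 0, 0],
    ![0, Real.cosh (x 0) ^ 2, 0],
    ![0, 0, Real.cosh (x 0) ^ 2 * Real.sin (x 1) ^ 2]]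

/-- The inverse metric `h⁰^{ab}`. -/
noncomputable def h0inv (x : Pt) : Fin 3 → Fin 3 → ℝ :=
  ![![-1, 0, 0],
    ![0, 1 / Real.cosh (x 0) ^ 2, 0],
    ![0, 0, 1 / (Real.cosh (x 0) ^ 2 * Real.sin (x 1) ^ 2)]]

/-- Christoffel symbols `Γ^c_{ab}` of `h⁰`; first index is the upper index. -/
noncomputable def Chr (x : Pt) : Fin 3 → Fin 3 → Fin 3 → ℝ :=
  ![![![0, 0, 0],
      ![0, Real.sinh (x 0) * Real.cosh (x 0), 0],
      ![0, 0, Real.sinh (x 0) * Real.cosh (x 0) * Real.sin (x 1) ^ 2]],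
    ![![0, Real.tanh (x 0), 0],
      ![Real.tanh (x 0), 0, 0],
      ![0, 0, -(Real.sin (x 1) * Real.cos (x 1))]],
    ![![0, 0, Real.tanh (x 0)],
      ![0, 0, Real.cos (x 1) / Real.sin (x 1)],
      ![Real.tanh (x 0), Real.cos (x 1) / Real.sin (x 1), 0]]]

/-- Covariant Hessian `D_a D_b f = ∂_a ∂_b f - Σ_c Γ^c_{ab} ∂_c f`. -/
noncomputable def hess (f : Pt → ℝ) (x : Pt) (a b : Fin 3) : ℝ :=
  pd a (pd b f) x - ∑ c, Chr x c a b * pd c f x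

/-- Covariant derivative `D_c T_{ab}` of a 2-tensor. -/
noncomputable def covD (T : Pt → Fin 3 → Fin 3 → ℝ) (x : Pt) (c a b : Fin 3) : ℝ :=
  pd c (fun y => T y a b) x - (∑ d, Chr x d c a * T x d b) - (∑ d, Chr x d c b * T x a d)

/-- Second covariant derivative `D_d D_c T_{ab}`, treating `D_c T_{ab}` as a 3-tensor. -/
noncomputable def covD2 (T : Pt → Fin 3 → Fin 3 → ℝ) (x : Pt) (d c a b : Fin 3) : ℝ :=
  pd d (fun y => covD T y c a b) x
    - (∑ e, Chr x e d c * covD T x e a b)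
    - (∑ e, Chr x e d a * covD T x c e b)
    - (∑ e, Chr x e d b * covD T x c a e)

/-- Tensor Laplacian `□T_{ab} = Σ_{c,d} h⁰^{cd} D_d D_c T_{ab}`. -/
noncomputable def boxT (T : Pt → Fin 3 → Fin 3 → ℝ) (x : Pt) (a b : Fin 3) : ℝ :=
  ∑ c, ∑ d, h0inv x c d * covD2 T x d c a b

/-- Totally antisymmetric Levi-Civita symbol with `levi 0 1 2 = 1`. -/
def levi : Fin 3 → Fin 3 → Fin 3 → ℝ :=
  ![![![0, 0, 0], ![0, 0, 1], ![0, -1, 0]],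
    ![![0, 0, -1], ![0, 0, 0], ![1, 0, 0]],
    ![![0, 1, 0], ![-1, 0, 0], ![0, 0, 0]]]

/-- Volume tensor `ε_{abc}` with `ε_{τθφ} = cosh²τ sinθ`. -/
noncomputable def epsLow (x : Pt) (a b c : Fin 3) : ℝ :=
  levi a b c * (Real.cosh (x 0) ^ 2 * Real.sin (x 1))

/-- `ε_a{}^{cd} = Σ_{e,f} ε_{aef} h⁰^{ec} h⁰^{fd}`. -/
noncomputable def epsMixed (x : Pt) (a c d : Fin 3) : ℝ :=
  ∑ e, ∑ f, epsLow x a e f * h0inv x e c * h0inv x f d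

/-- Curl of a 2-tensor: `(curl T)_{ab} = Σ_{c,d} ε_a{}^{cd} D_c T_{db}`. -/
noncomputable def curlT (T : Pt → Fin 3 → Fin 3 → ℝ) (x : Pt) (a b : Fin 3) : ℝ :=
  ∑ c, ∑ d, epsMixed x a c d * covD T x c d b

lemma isOpen_U : IsOpen U :=
  (isOpen_lt continuous_const (continuous_apply 1)).inter
    (isOpen_lt (continuous_apply 1) continuous_const)

lemma U_mem_nhds {x : Pt} (hx : x ∈ U) : U ∈ nhds x := isOpen_U.mem_nhds hx

lemma sin_ne_zero_of_mem_U {x : Pt} (hx : x ∈ U) : Real.sin (x 1) ≠ 0 :=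
  (Real.sin_pos_of_pos_of_lt_pi hx.1 hx.2).ne'

lemma cosh_ne_zero (t : ℝ) : Real.cosh t ≠ 0 := (Real.cosh_pos t).ne'

/-- Smooth scalar functions on the chart. -/
def SmoothU (f : Pt → ℝ) : Prop := ContDiffOn ℝ (⊤ : ℕ∞) f U

namespace SmoothU

variable {f g : Pt → ℝ} {x : Pt}

lemma contDiffAt (hf : SmoothU f) (hx : x ∈ U) : ContDiffAt ℝ (⊤ : ℕ∞) f x :=
  ContDiffOn.contDiffAt hf (U_mem_nhds hx)

lemma differentiableAt (hf : SmoothU f) (hx : x ∈ U) : DifferentiableAt ℝ f x :=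
  (hf.contDiffAt hx).differentiableAt (by simp)

lemma mul (hf : SmoothU f) (hg : SmoothU g) : SmoothU fun y => f y * g y :=
  ContDiffOn.mul hf hg

lemma sub (hf : SmoothU f) (hg : SmoothU g) : SmoothU fun y => f y - g y :=
  ContDiffOn.sub hf hg

lemma sum {F : Fin 3 → Pt → ℝ} (hF : ∀ i, SmoothU (F i)) : SmoothU fun y => ∑ i, F i y :=
  ContDiffOn.sum fun i _ => hF i

end SmoothU

section PartialDerivatives

variable {f g : Pt → ℝ} {x : Pt}

lemma hasDerivAt_pd (i : Fin 3) (hf : DifferentiableAt ℝ f x) :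
    HasDerivAt (fun t => f (Function.update x i t)) (fderiv ℝ f x (Pi.single i 1)) (x i) := by
  have h := hasDerivAt_update x i (x i)
  have hf' : HasFDerivAt f (fderiv ℝ f x) (Function.update x i (x i)) := by
    simpa using hf.hasFDerivAt
  exact hf'.comp_hasDerivAt (x i) h

lemma pd_eq_fderiv (i : Fin 3) (hf : DifferentiableAt ℝ f x) :
    pd i f x = fderiv ℝ f x (Pi.single i 1) :=
  (hasDerivAt_pd i hf).deriv

lemma SmoothU.pd (hf : SmoothU f) (i : Fin 3) : SmoothU (pd i f) := by
  have h : ContDiffOn ℝ (⊤ : ℕ∞) (fun y => fderiv ℝ f y (Pi.single i 1)) U :=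
    (hf.fderiv_of_isOpen isOpen_U (by simp)).clm_apply contDiffOn_const
  exact h.congr fun y hy => pd_eq_fderiv i (hf.differentiableAt hy)

lemma pd_congr (i : Fin 3) (h : ∀ y ∈ U, f y = g y) (hx : x ∈ U) : pd i f x = pd i g x := by
  refine Filter.EventuallyEq.deriv_eq ?_
  have hc : Filter.Tendsto (fun t => Function.update x i t) (nhds (x i)) (nhds x) := by
    have h : Continuous fun t => Function.update x i t := continuous_const.update i continuous_id
    simpa using h.tendsto (x i)
  filter_upwards [hc (U_mem_nhds hx)] with t ht using h _ ht

lemma pd_mul (i : Fin 3) (hf : SmoothU f) (hg : SmoothU g) (hx : x ∈ U) :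
    pd i (fun y => f y * g y) x = pd i f x * g x + f x * pd i g x := by
  have h := (hasDerivAt_pd i (hf.differentiableAt hx)).fun_mul
    (hasDerivAt_pd i (hg.differentiableAt hx))
  rw [pd_eq_fderiv i (hf.differentiableAt hx), pd_eq_fderiv i (hg.differentiableAt hx)]
  simpa [pd] using h.deriv

lemma pd_sub (i : Fin 3) (hf : SmoothU f) (hg : SmoothU g) (hx : x ∈ U) :
    pd i (fun y => f y - g y) x = pd i f x - pd i g x := by
  rw [pd_eq_fderiv i (hf.differentiableAt hx), pd_eq_fderiv i (hg.differentiableAt hx)]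
  exact ((hasDerivAt_pd i (hf.differentiableAt hx)).sub
    (hasDerivAt_pd i (hg.differentiableAt hx))).deriv

lemma pd_sum (i : Fin 3) {F : Fin 3 → Pt → ℝ} (hF : ∀ j, SmoothU (F j)) (hx : x ∈ U) :
    pd i (fun y => ∑ j, F j y) x = ∑ j, pd i (F j) x := by
  rw [Finset.sum_congr rfl fun j _ => pd_eq_fderiv i ((hF j).differentiableAt hx)]
  have h : HasDerivAt (fun t => ∑ j, F j (Function.update x i t))
      (∑ j, fderiv ℝ (F j) x (Pi.single i 1)) (x i) :=
    HasDerivAt.fun_sum fun j _ => hasDerivAt_pd i ((hF j).differentiableAt hx)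
  exact h.deriv

lemma pd_comm (i j : Fin 3) (hf : SmoothU f) (hx : x ∈ U) :
    pd i (pd j f) x = pd j (pd i f) x := by
  have key (k l : Fin 3) :
      pd k (pd l f) x = fderiv ℝ (fderiv ℝ f) x (Pi.single k 1) (Pi.single l 1) := by
    have h1 : DifferentiableAt ℝ (fderiv ℝ f) x :=
      ((hf.contDiffAt hx).fderiv_right (m := 1) (by norm_cast)).differentiableAt (by simp)
    rw [pd_congr k (fun y hy => pd_eq_fderiv l (hf.differentiableAt hy)) hx,
      pd_eq_fderiv k (h1.clm_apply (differentiableAt_const _)),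
      fderiv_clm_apply h1 (differentiableAt_const _)]
    simp
  rw [key, key]
  exact ((hf.contDiffAt hx).isSymmSndFDerivAt (by simp; norm_cast)) _ _

end PartialDerivatives

section Coefficients

lemma smoothU_Chr (a b c : Fin 3) : SmoothU fun y => Chr y a b c := by
  have hs : ∀ y ∈ U, Real.sin (y 1) ≠ 0 := fun y => sin_ne_zero_of_mem_U
  have hc : ∀ y ∈ U, Real.cosh (y 0) ≠ 0 := fun y _ => cosh_ne_zero _
  unfold SmoothU
  fin_cases a <;> fin_cases b <;> fin_cases c <;>
    simp [Chr, Real.tanh_eq_sinh_div_cosh] <;> fun_prop (disch := assumption)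

lemma smoothU_h0inv (a b : Fin 3) : SmoothU fun y => h0inv y a b := by
  have hs : ∀ y ∈ U, Real.cosh (y 0) ^ 2 * Real.sin (y 1) ^ 2 ≠ 0 := fun y hy =>
    mul_ne_zero (pow_ne_zero _ (cosh_ne_zero _)) (pow_ne_zero _ (sin_ne_zero_of_mem_U hy))
  have hc : ∀ y ∈ U, Real.cosh (y 0) ^ 2 ≠ 0 := fun y _ => pow_ne_zero _ (cosh_ne_zero _)
  unfold SmoothU
  fin_cases a <;> fin_cases b <;>
    simp [h0inv, -mul_inv_rev] <;> fun_prop (disch := assumption)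

lemma smoothU_epsMixed (a c d : Fin 3) : SmoothU fun y => epsMixed y a c d := by
  have h : SmoothU fun y => Real.cosh (y 0) ^ 2 * Real.sin (y 1) := by
    unfold SmoothU; fun_prop
  have hl (e f : Fin 3) : SmoothU fun _ => levi a e f := contDiffOn_const
  exact .sum fun e => .sum fun f =>
    (((hl e f).mul h).mul (smoothU_h0inv e c)).mul (smoothU_h0inv f d)

lemma Chr_symm (x : Pt) (a b c : Fin 3) : Chr x a b c = Chr x a c b := by
  fin_cases a <;> fin_cases b <;> fin_cases c <;> simp [Chr]

end Coefficients

section CoefficientIdentities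

variable {x : Pt}

lemma deriv_sinh_mul_cosh (t : ℝ) :
    deriv (fun s => Real.sinh s * Real.cosh s) t = Real.cosh t ^ 2 + Real.sinh t ^ 2 := by
  rw [((Real.hasDerivAt_sinh t).fun_mul (Real.hasDerivAt_cosh t)).deriv]; ring

lemma deriv_sinh_div_cosh (t : ℝ) :
    deriv (fun s => Real.sinh s / Real.cosh s) t = 1 / Real.cosh t ^ 2 := by
  have h := ((Real.hasDerivAt_sinh t).fun_div (Real.hasDerivAt_cosh t) (cosh_ne_zero t)).deriv
  rw [h, ← Real.cosh_sq_sub_sinh_sq t]; ring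

lemma deriv_sin_mul_cos (t : ℝ) :
    deriv (fun s => Real.sin s * Real.cos s) t = Real.cos t ^ 2 - Real.sin t ^ 2 := by
  rw [((Real.hasDerivAt_sin t).fun_mul (Real.hasDerivAt_cos t)).deriv]; ring

lemma deriv_cos_div_sin {t : ℝ} (ht : Real.sin t ≠ 0) :
    deriv (fun s => Real.cos s / Real.sin s) t = -1 / Real.sin t ^ 2 := by
  rw [((Real.hasDerivAt_cos t).fun_div (Real.hasDerivAt_sin t) ht).deriv]
  congr 1
  linarith [Real.sin_sq_add_cos_sq t]

lemma deriv_inv_cosh_sq (t : ℝ) :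
    deriv (fun s => (Real.cosh s ^ 2)⁻¹) t = -(2 * Real.sinh t / Real.cosh t ^ 3) := by
  have hc := cosh_ne_zero t
  rw [(((Real.hasDerivAt_cosh t).fun_pow 2).fun_inv (pow_ne_zero 2 hc)).deriv]
  field_simp; simp; ring

lemma deriv_inv_sin {t : ℝ} (ht : Real.sin t ≠ 0) :
    deriv (fun s => (Real.sin s)⁻¹) t = -Real.cos t / Real.sin t ^ 2 :=
  ((Real.hasDerivAt_sin t).fun_inv ht).deriv

lemma deriv_inv_sin_sq {t : ℝ} (ht : Real.sin t ≠ 0) :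
    deriv (fun s => (Real.sin s ^ 2)⁻¹) t = -(2 * Real.cos t / Real.sin t ^ 3) := by
  rw [(((Real.hasDerivAt_sin t).fun_pow 2).fun_inv (pow_ne_zero 2 ht)).deriv]
  field_simp; simp; ring

/-- The curvature of the metric: unit constant curvature. -/
lemma riemann_eq (hx : x ∈ U) (d c e a : Fin 3) :
    pd d (fun y => Chr y e c a) x - pd c (fun y => Chr y e d a) x
      + ∑ f, (Chr x f c a * Chr x e d f - Chr x f d a * Chr x e c f)
      = (if e = d then h0 x a c else 0) - (if e = c then h0 x a d else 0) := by
  have hs := sin_ne_zero_of_mem_U hx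
  have hc := cosh_ne_zero (x 0)
  have h1 := Real.cosh_sq_sub_sinh_sq (x 0)
  have h2 := Real.sin_sq_add_cos_sq (x 1)
  fin_cases d <;> fin_cases c <;> fin_cases e <;> fin_cases a <;>
    simp [pd, Chr, h0, Fin.sum_univ_three, Real.tanh_eq_sinh_div_cosh, Function.update,
      deriv_sinh_div_cosh, deriv_cos_div_sin hs, deriv_sin_mul_cos,
      deriv_sinh_mul_cosh, -deriv_fun_mul]
    <;> field_simp <;> grind

/-- The components of `ε_a{}^{cd}` on the chart. -/
def epsVal (x : Pt) : Fin 3 → Fin 3 → Fin 3 → ℝ :=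
  ![![![0, 0, 0],
      ![0, 0, (Real.cosh (x 0) ^ 2)⁻¹ * (Real.sin (x 1))⁻¹],
      ![0, -((Real.cosh (x 0) ^ 2)⁻¹ * (Real.sin (x 1))⁻¹), 0]],
    ![![0, 0, (Real.sin (x 1))⁻¹], ![0, 0, 0], ![-(Real.sin (x 1))⁻¹, 0, 0]],
    ![![0, -Real.sin (x 1), 0], ![Real.sin (x 1), 0, 0], ![0, 0, 0]]]

lemma epsMixed_eq (hx : x ∈ U) (a c d : Fin 3) : epsMixed x a c d = epsVal x a c d := by
  have hs := sin_ne_zero_of_mem_U hx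
  have hc := cosh_ne_zero (x 0)
  fin_cases a <;> fin_cases c <;> fin_cases d <;>
    simp [epsMixed, epsVal, epsLow, levi, h0inv, Fin.sum_univ_three] <;> field_simp

lemma epsMixed_contract (hx : x ∈ U) (a c e f : Fin 3) :
    ∑ d, epsMixed x a c d * epsMixed x d e f
      = (if a = f then h0inv x c e else 0) - (if a = e then h0inv x c f else 0) := by
  have hs := sin_ne_zero_of_mem_U hx
  have hc := cosh_ne_zero (x 0)
  simp only [epsMixed_eq hx]
  fin_cases a <;> fin_cases c <;> fin_cases e <;> fin_cases f <;>
    simp [epsVal, h0inv, Fin.sum_univ_three] <;> field_simp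

lemma pd_epsMixed (hx : x ∈ U) (c a d e : Fin 3) :
    pd c (fun y => epsMixed y a d e) x
      = ∑ f, (Chr x f c a * epsMixed x f d e - Chr x d c f * epsMixed x a f e
          - Chr x e c f * epsMixed x a d f) := by
  have hs := sin_ne_zero_of_mem_U hx
  have hc := cosh_ne_zero (x 0)
  rw [pd_congr c (fun y hy => epsMixed_eq hy a d e) hx]
  simp only [epsMixed_eq hx]
  fin_cases c <;> fin_cases a <;> fin_cases d <;> fin_cases e <;>
    simp [pd, Chr, epsVal, Fin.sum_univ_three, Real.tanh_eq_sinh_div_cosh, Function.update,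
      deriv_inv_cosh_sq, deriv_inv_sin hs]
    <;> field_simp <;> ring

lemma pd_h0inv (hx : x ∈ U) (c a b : Fin 3) :
    pd c (fun y => h0inv y a b) x
      = -∑ e, (Chr x a c e * h0inv x e b + Chr x b c e * h0inv x a e) := by
  have hs := sin_ne_zero_of_mem_U hx
  have hc := cosh_ne_zero (x 0)
  fin_cases c <;> fin_cases a <;> fin_cases b <;>
    simp [pd, Chr, h0inv, Fin.sum_univ_three, Real.tanh_eq_sinh_div_cosh, Function.update,
      deriv_inv_cosh_sq, deriv_inv_sin_sq hs]
    <;> field_simp <;> ring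

lemma h0inv_symm (x : Pt) (a b : Fin 3) : h0inv x a b = h0inv x b a := by
  fin_cases a <;> fin_cases b <;> simp [h0inv]

end CoefficientIdentities

section Tensors

variable {P : Pt → Fin 3 → Fin 3 → ℝ} {x : Pt}

/-- The trace `h⁰^{ab} P_{ab}`. -/
def trace (P : Pt → Fin 3 → Fin 3 → ℝ) (x : Pt) : ℝ := ∑ a, ∑ b, h0inv x a b * P x a b

lemma smoothU_covD (hP : ∀ a b, SmoothU fun y => P y a b) (c a b : Fin 3) :
    SmoothU fun y => covD P y c a b :=
  (((hP a b).pd c).sub (.sum fun d => (smoothU_Chr d c a).mul (hP d b))).sub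
    (.sum fun d => (smoothU_Chr d c b).mul (hP a d))

lemma pd_covD (hP : ∀ a b, SmoothU fun y => P y a b) (hx : x ∈ U) (d c a b : Fin 3) :
    pd d (fun y => covD P y c a b) x
      = pd d (pd c fun y => P y a b) x
        - ∑ e, (pd d (fun y => Chr y e c a) x * P x e b
            + Chr x e c a * pd d (fun y => P y e b) x)
        - ∑ e, (pd d (fun y => Chr y e c b) x * P x a e
            + Chr x e c b * pd d (fun y => P y a e) x) := by
  have h1 (e : Fin 3) := (smoothU_Chr e c a).mul (hP e b)
  have h2 (e : Fin 3) := (smoothU_Chr e c b).mul (hP a e)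
  simp only [covD]
  rw [pd_sub d (((hP a b).pd c).sub (.sum h1)) (.sum h2) hx,
    pd_sub d ((hP a b).pd c) (.sum h1) hx, pd_sum d h1 hx, pd_sum d h2 hx]
  simp only [pd_mul d (smoothU_Chr _ c a) (hP _ b) hx, pd_mul d (smoothU_Chr _ c b) (hP a _) hx]

/-- The Ricci identity on the unit hyperboloid. -/
lemma covD2_comm (hP : ∀ a b, SmoothU fun y => P y a b) (hx : x ∈ U) (d c a b : Fin 3) :
    covD2 P x d c a b - covD2 P x c d a b
      = h0 x a d * P x c b - h0 x a c * P x d b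
        + (h0 x b d * P x a c - h0 x b c * P x a d) := by
  have hpd := pd_comm d c (hP a b) hx
  have hra (e : Fin 3) := riemann_eq hx d c e a
  have hrb (e : Fin 3) := riemann_eq hx d c e b
  have sa : ∑ e, ((if e = d then h0 x a c else 0) - if e = c then h0 x a d else 0) * P x e b
      = h0 x a c * P x d b - h0 x a d * P x c b := by
    simp [sub_mul, Finset.sum_sub_distrib]
  have sb : ∑ e, ((if e = d then h0 x b c else 0) - if e = c then h0 x b d else 0) * P x a e
      = h0 x b c * P x a d - h0 x b d * P x a c := by
    simp [sub_mul, Finset.sum_sub_distrib]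
  simp only [← hra] at sa
  simp only [← hrb] at sb
  simp only [covD2, pd_covD hP hx, Chr_symm x _ d c]
  simp only [covD]
  simp only [Fin.sum_univ_three] at sa sb ⊢
  linear_combination hpd - sa - sb

/-- The volume tensor is parallel. -/
lemma covD_curlT (hP : ∀ a b, SmoothU fun y => P y a b) (hx : x ∈ U) (c a b : Fin 3) :
    covD (fun y => curlT P y) x c a b
      = ∑ d, ∑ e, epsMixed x a d e * covD2 P x c d e b := by
  have h (d e : Fin 3) := (smoothU_epsMixed a d e).mul (smoothU_covD hP d e b)
  have hpd : pd c (fun y => curlT P y a b) x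
      = ∑ d, ∑ e, (pd c (fun y => epsMixed y a d e) x * covD P x d e b
          + epsMixed x a d e * pd c (fun y => covD P y d e b) x) := by
    simp only [curlT]
    rw [pd_sum c (fun d => .sum (h d)) hx]
    refine Finset.sum_congr rfl fun d _ => ?_
    rw [pd_sum c (h d) hx]
    exact Finset.sum_congr rfl fun e _ =>
      pd_mul c (smoothU_epsMixed a d e) (smoothU_covD hP d e b) hx
  rw [covD, hpd]
  simp only [pd_epsMixed hx, curlT, covD2, Fin.sum_univ_three]
  ring

/-- The Hessian of the trace is the trace of the second covariant derivative when the
divergence equals the gradient of the trace. -/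
lemma contract_covD2_eq_hess (hP : ∀ a b, SmoothU fun y => P y a b)
    (hsym : ∀ y ∈ U, ∀ a b, P y a b = P y b a)
    (hdiv : ∀ y ∈ U, ∀ a, ∑ b, ∑ c, h0inv y b c * covD P y c a b = pd a (trace P) y)
    (hx : x ∈ U) (a b : Fin 3) :
    ∑ c, ∑ f, h0inv x c f * covD2 P x a c f b = hess (trace P) x a b := by
  have hcov (y) (hy : y ∈ U) (c a b : Fin 3) : covD P y c a b = covD P y c b a := by
    simp only [covD, pd_congr c (fun z hz => hsym z hz a b) hy, hsym y hy a, hsym y hy _ b]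
    ring
  have hdiv' (y) (hy : y ∈ U) (b : Fin 3) :
      pd b (trace P) y = ∑ c, ∑ f, h0inv y c f * covD P y c f b := by
    rw [← hdiv y hy b, Finset.sum_comm]
    simp only [h0inv_symm y, hcov y hy _ b]
  have h (c f : Fin 3) := (smoothU_h0inv c f).mul (smoothU_covD hP c f b)
  have hpd : pd a (pd b (trace P)) x
      = ∑ c, ∑ f, (pd a (fun y => h0inv y c f) x * covD P x c f b
          + h0inv x c f * pd a (fun y => covD P y c f b) x) := by
    rw [pd_congr a (fun y hy => hdiv' y hy b) hx, pd_sum a (fun c => .sum (h c)) hx]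
    refine Finset.sum_congr rfl fun c _ => ?_
    rw [pd_sum a (h c) hx]
    exact Finset.sum_congr rfl fun f _ =>
      pd_mul a (smoothU_h0inv c f) (smoothU_covD hP c f b) hx
  rw [hess, hpd]
  simp only [pd_h0inv hx, hdiv' x hx, covD2, Fin.sum_univ_three]
  ring

lemma curlT_curlT (hP : ∀ a b, SmoothU fun y => P y a b) (hx : x ∈ U) (a b : Fin 3) :
    curlT (fun y => curlT P y) x a b
      = boxT P x a b - ∑ c, ∑ f, h0inv x c f * covD2 P x c a f b := by
  have key (c : Fin 3) :
      ∑ d, epsMixed x a c d * ∑ e, ∑ f, epsMixed x d e f * covD2 P x c e f b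
        = ∑ e, ∑ f, ((if a = f then h0inv x c e else 0) - if a = e then h0inv x c f else 0)
            * covD2 P x c e f b := by
    simp only [← epsMixed_contract hx, Fin.sum_univ_three]
    ring
  rw [curlT]
  simp only [covD_curlT hP hx, key]
  simp only [boxT, sub_mul, Finset.sum_sub_distrib, ite_mul, zero_mul,
    Finset.sum_ite_eq, Finset.sum_ite_irrel, Finset.sum_const_zero, Finset.mem_univ, if_true]
  congr 1
  rw [Finset.sum_comm]
  simp only [h0inv_symm x]

lemma contract_covD2_comm (hP : ∀ a b, SmoothU fun y => P y a b)
    (hsym : ∀ y ∈ U, ∀ a b, P y a b = P y b a) (hx : x ∈ U) (a b : Fin 3) :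
    ∑ c, ∑ f, h0inv x c f * covD2 P x c a f b
      = ∑ c, ∑ f, h0inv x c f * covD2 P x a c f b + 3 * P x a b - trace P x * h0 x a b := by
  have hs := sin_ne_zero_of_mem_U hx
  have hc := cosh_ne_zero (x 0)
  have hR : ∑ c, ∑ f, h0inv x c f * (h0 x f c * P x a b - h0 x f a * P x c b
      + (h0 x b c * P x f a - h0 x b a * P x f c)) = 3 * P x a b - trace P x * h0 x a b := by
    have h10 := hsym x hx 1 0
    have h20 := hsym x hx 2 0
    have h21 := hsym x hx 2 1
    fin_cases a <;> fin_cases b <;>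
      simp [trace, h0, h0inv, Fin.sum_univ_three, h10, h20, h21] <;> field_simp <;> ring
  rw [add_sub_assoc, ← hR, ← sub_eq_iff_eq_add']
  simp only [← Finset.sum_sub_distrib, ← mul_sub]
  refine Finset.sum_congr rfl fun c _ => Finset.sum_congr rfl fun f _ => ?_
  rw [covD2_comm hP hx c a f b]

end Tensors

/-- Lemma 2 (curl-free part): for `P_{ab}` symmetric with
`D^bP_{ab} - D_aP = 0` and `(□-3)P_{ab} + P h⁰_{ab} - D_aD_bP = 0`, the tensor
`T_{ab} = Σ_{c,d} ε_a{}^{cd} D_cP_{db}` is curl-free on `U`. -/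
theorem stmt8 (P : Pt → Fin 3 → Fin 3 → ℝ)
    (hP : ∀ a b : Fin 3, ContDiffOn ℝ (⊤ : ℕ∞) (fun x => P x a b) U)
    (hsym : ∀ x ∈ U, ∀ a b : Fin 3, P x a b = P x b a)
    (hdiv : ∀ x ∈ U, ∀ a : Fin 3,
      (∑ b, ∑ c, h0inv x b c * covD P x c a b)
        - pd a (fun y => ∑ a', ∑ b', h0inv y a' b' * P y a' b') x = 0)
    (heq : ∀ x ∈ U, ∀ a b : Fin 3,
      boxT P x a b - 3 * P x a b
        + (∑ a', ∑ b', h0inv x a' b' * P x a' b') * h0 x a b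
        - hess (fun y => ∑ a', ∑ b', h0inv y a' b' * P y a' b') x a b = 0) :
    ∀ x ∈ U, ∀ a b : Fin 3, curlT (fun y => curlT P y) x a b = 0 := by
  intro x hx a b
  have hdiv' : ∀ y ∈ U, ∀ a, ∑ b, ∑ c, h0inv y b c * covD P y c a b = pd a (trace P) y :=
    fun y hy a => sub_eq_zero.mp (hdiv y hy a)
  have h : boxT P x a b - 3 * P x a b + trace P x * h0 x a b - hess (trace P) x a b = 0 :=
    heq x hx a b
  rw [curlT_curlT hP hx, contract_covD2_comm hP hsym hx,
    contract_covD2_eq_hess hP hsym hdiv' hx]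
  linear_combination h
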